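/- Let T > 0 and ε > 0. There exists a constant C = C(T, ε) > 0 such that for all times 0 < s₁ < t₁ ≤ T and 0 < s₂ < t₂ ≤ T with t₁, t₂, s₁, s₂ pairwise distinct, all integers n ≥ 1, and all points y₁, y₂, z₁, z₂ ∈ ℝ³, one has 𝒞⁽ⁿ⁾_{t₁,t₂}(z₁,z₂) · ∫_{ℝ³} ∫_{ℝ³} K_{t₁−s₁}(y₁,w₁) · K_{t₂−s₂}(y₂,w₂) · 𝒞⁽ⁿ⁾_{t₁,s₂}(z₁,w₂) · 𝒞⁽ⁿ⁾_{t₂,s₁}(z₂,w₁) · 𝒞⁽ⁿ⁾_{s₁,s₂}(w₁,w₂)² dw₁ dw₂ ≤ C · |t₁−t₂|^{−1/2} · |t₁−s₂|^{−1/2} · |t₂−s₁|^{−1/2} · |t₁−s₁|^{−1/2} · |t₂−s₂|^{−1/2} · |s₁−s₂|^{−ε}. -/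

import Mathlib

open MeasureTheory Real

noncomputable section

/-- Mehler heat kernel of the harmonic oscillator `H = -Δ + |x|²` on `ℝ³`. -/
def mehlerK (t : ℝ) (x y : EuclideanSpace ℝ (Fin 3)) : ℝ :=
  (2 * π * Real.sinh (2 * t)) ^ (-(3 : ℝ) / 2) *
    Real.exp (-‖x - y‖ ^ 2 / (4 * Real.tanh t) - Real.tanh t * ‖x + y‖ ^ 2 / 4)

/-- The regularized covariance `𝒞⁽ⁿ⁾_{t₁,t₂}(y₁,y₂)`, with `ε_n = 2^{-n}`. -/
def covC (n : ℕ) (t₁ t₂ : ℝ) (y₁ y₂ : EuclideanSpace ℝ (Fin 3)) : ℝ :=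
  (1 / 2) * ∫ σ in (|t₂ - t₁| + 2 * (2 : ℝ) ^ (-(n : ℝ)))..(t₁ + t₂ + 2 * (2 : ℝ) ^ (-(n : ℝ))),
    mehlerK σ y₁ y₂

local notation "E3" => EuclideanSpace ℝ (Fin 3)

lemma tanh_le_self_of_pos {t : ℝ} (ht : 0 < t) : Real.tanh t ≤ t := by
  obtain ⟨c, hc, h⟩ := exists_hasDerivAt_eq_slope Real.sinh Real.cosh ht
    Real.continuous_sinh.continuousOn fun x _ => Real.hasDerivAt_sinh x
  have hle : Real.cosh c ≤ Real.cosh t := by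
    rw [Real.cosh_le_cosh, abs_of_pos hc.1, abs_of_pos ht]
    exact hc.2.le
  rw [Real.tanh_eq_sinh_div_cosh, div_le_iff₀ (Real.cosh_pos t)]
  rw [h, Real.sinh_zero, sub_zero, sub_zero, div_le_iff₀ ht] at hle
  linarith

/-- The heat kernel of `-Δ` on `ℝ³`, without its numerical normalisation. -/
def gaussKernel (t : ℝ) (x : E3) : ℝ :=
  t ^ (-(3 : ℝ) / 2) * Real.exp (-‖x‖ ^ 2 / (4 * t))

lemma gaussKernel_nonneg {t : ℝ} (ht : 0 < t) (x : E3) : 0 ≤ gaussKernel t x := by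
  unfold gaussKernel
  positivity

lemma measurable_gaussKernel (t : ℝ) : Measurable (gaussKernel t) := by
  unfold gaussKernel
  fun_prop

lemma gaussKernel_le_rpow {t : ℝ} (ht : 0 < t) (x : E3) :
    gaussKernel t x ≤ t ^ (-(3 : ℝ) / 2) := by
  unfold gaussKernel
  refine mul_le_of_le_one_right (by positivity) ?_
  rw [Real.exp_le_one_iff, neg_div]
  exact neg_nonpos.2 (by positivity)

lemma gaussKernel_le_inv_mul_inv_norm {t : ℝ} (ht : 0 < t) {x : E3} (hx : x ≠ 0) :
    gaussKernel t x ≤ t⁻¹ * (2 * ‖x‖⁻¹) := by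
  have hr : 0 < ‖x‖ := norm_pos_iff.2 hx
  have hs : 0 < √t := Real.sqrt_pos.2 ht
  have hpow : t ^ (-(3 : ℝ) / 2) = t⁻¹ * (√t)⁻¹ := by
    rw [Real.sqrt_eq_rpow, ← Real.rpow_neg_one, ← Real.rpow_neg ht.le, ← Real.rpow_add ht]
    norm_num
  have hexp : ‖x‖ / (2 * √t) ≤ Real.exp (‖x‖ ^ 2 / (4 * t)) := by
    have h1 := Real.add_one_le_exp (‖x‖ ^ 2 / (4 * t))
    have h2 : ‖x‖ ^ 2 / (4 * t) = (‖x‖ / (2 * √t)) ^ 2 := by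
      rw [div_pow, mul_pow, Real.sq_sqrt ht.le]
      norm_num
    rw [h2] at h1 ⊢
    nlinarith [sq_nonneg (‖x‖ / (2 * √t) - 1)]
  unfold gaussKernel
  rw [hpow, neg_div, Real.exp_neg, mul_assoc]
  refine mul_le_mul_of_nonneg_left ?_ (by positivity)
  calc (√t)⁻¹ * (Real.exp (‖x‖ ^ 2 / (4 * t)))⁻¹ ≤ (√t)⁻¹ * (‖x‖ / (2 * √t))⁻¹ := by gcongr
    _ = 2 * ‖x‖⁻¹ := by field_simp

lemma mehlerK_nonneg {t : ℝ} (ht : 0 < t) (x y : E3) : 0 ≤ mehlerK t x y := by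
  have : 0 < Real.sinh (2 * t) := Real.sinh_pos_iff.2 (by positivity)
  unfold mehlerK
  positivity

lemma mehlerK_le_gaussKernel {t : ℝ} (ht : 0 < t) (x y : E3) :
    mehlerK t x y ≤ gaussKernel t (x - y) := by
  have hsinh : 2 * t ≤ Real.sinh (2 * t) := Real.self_le_sinh_iff.2 (by positivity)
  have htanh : 0 < Real.tanh t := by
    rw [Real.tanh_eq_sinh_div_cosh]
    exact div_pos (Real.sinh_pos_iff.2 ht) (Real.cosh_pos t)
  unfold mehlerK gaussKernel
  apply mul_le_mul _ _ (by positivity) (by positivity)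
  · refine Real.rpow_le_rpow_of_nonpos ht ?_ (by norm_num)
    nlinarith [Real.pi_gt_three]
  · refine Real.exp_le_exp.2 ?_
    have h1 : ‖x - y‖ ^ 2 / (4 * t) ≤ ‖x - y‖ ^ 2 / (4 * Real.tanh t) := by
      gcongr
      exact tanh_le_self_of_pos ht
    have h2 : 0 ≤ Real.tanh t * ‖x + y‖ ^ 2 / 4 := by positivity
    rw [neg_div, neg_div]
    linarith

lemma intervalIntegral_mono_of_nonneg {f g : ℝ → ℝ} {a b : ℝ} (hab : a ≤ b)
    (hf : ∀ x ∈ Set.Ioc a b, 0 ≤ f x) (hg : IntervalIntegrable g volume a b)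
    (hfg : ∀ x ∈ Set.Ioc a b, f x ≤ g x) : ∫ x in a..b, f x ≤ ∫ x in a..b, g x := by
  rw [intervalIntegral.integral_of_le hab, intervalIntegral.integral_of_le hab]
  exact integral_mono_of_nonneg (ae_restrict_of_forall_mem measurableSet_Ioc hf) hg.1
    (ae_restrict_of_forall_mem measurableSet_Ioc hfg)

section Covariance

variable {n : ℕ} {t₁ t₂ : ℝ}

lemma abs_sub_add_le (h₁ : 0 < t₁) (h₂ : 0 < t₂) (δ : ℝ) : |t₂ - t₁| + δ ≤ t₁ + t₂ + δ := by
  have : |t₂ - t₁| ≤ t₁ + t₂ := abs_sub_le_iff.2 ⟨by linarith, by linarith⟩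
  linarith

lemma covC_nonneg (h₁ : 0 < t₁) (h₂ : 0 < t₂) (x y : E3) : 0 ≤ covC n t₁ t₂ x y := by
  unfold covC
  refine mul_nonneg (by norm_num) ?_
  refine intervalIntegral.integral_nonneg (abs_sub_add_le h₁ h₂ _) fun σ hσ => ?_
  exact mehlerK_nonneg (lt_of_lt_of_le (by positivity) hσ.1) x y

lemma covC_le_rpow (h₁ : 0 < t₁) (h₂ : 0 < t₂) (hne : t₁ ≠ t₂) (x y : E3) :
    covC n t₁ t₂ x y ≤ |t₁ - t₂| ^ (-(1 : ℝ) / 2) := by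
  have hτ : 0 < |t₁ - t₂| := abs_pos.2 (sub_ne_zero.2 hne)
  have hδ : (0 : ℝ) < 2 * (2 : ℝ) ^ (-(n : ℝ)) := by positivity
  have hab := abs_sub_add_le h₁ h₂ (2 * (2 : ℝ) ^ (-(n : ℝ)))
  unfold covC
  rw [abs_sub_comm t₂ t₁] at *
  set δ := 2 * (2 : ℝ) ^ (-(n : ℝ))
  set a := |t₁ - t₂| + δ
  set b := t₁ + t₂ + δ
  have ha : 0 < a := by positivity
  have h0 : (0 : ℝ) ∉ Set.uIcc a b := Set.notMem_uIcc_of_lt ha (ha.trans_le hab)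
  have hint : ∫ σ in a..b, mehlerK σ x y ≤ ∫ σ in a..b, σ ^ (-(3 : ℝ) / 2) := by
    refine intervalIntegral_mono_of_nonneg hab (fun σ hσ => mehlerK_nonneg (ha.trans hσ.1) x y)
      (intervalIntegral.intervalIntegrable_rpow (Or.inr h0)) fun σ hσ => ?_
    exact (mehlerK_le_gaussKernel (ha.trans hσ.1) x y).trans
      (gaussKernel_le_rpow (ha.trans hσ.1) _)
  rw [integral_rpow (Or.inr ⟨by norm_num, h0⟩)] at hint
  have hexp : (-(3 : ℝ) / 2 + 1) = -(1 : ℝ) / 2 := by norm_num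
  rw [hexp] at hint
  have hb : 0 ≤ b ^ (-(1 : ℝ) / 2) := Real.rpow_nonneg (ha.le.trans hab) _
  have hmono : a ^ (-(1 : ℝ) / 2) ≤ |t₁ - t₂| ^ (-(1 : ℝ) / 2) :=
    Real.rpow_le_rpow_of_nonpos hτ (by linarith) (by norm_num)
  linarith

lemma covC_le_log_mul_inv_norm {T : ℝ} (hn : 1 ≤ n) (h₁ : 0 < t₁) (h₂ : 0 < t₂) (hT₁ : t₁ ≤ T)
    (hT₂ : t₂ ≤ T) (hne : t₁ ≠ t₂) {x y : E3} (hxy : x ≠ y) :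
    covC n t₁ t₂ x y ≤ Real.log ((2 * T + 1) / |t₁ - t₂|) * ‖x - y‖⁻¹ := by
  have hτ : 0 < |t₁ - t₂| := abs_pos.2 (sub_ne_zero.2 hne)
  have hδ : (0 : ℝ) < 2 * (2 : ℝ) ^ (-(n : ℝ)) := by positivity
  have hδ1 : 2 * (2 : ℝ) ^ (-(n : ℝ)) ≤ 1 := by
    have : (2 : ℝ) ^ (-(n : ℝ)) ≤ 2 ^ (-(1 : ℝ)) :=
      Real.rpow_le_rpow_of_exponent_le (by norm_num) (by simpa using hn)
    rw [Real.rpow_neg_one] at this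
    linarith
  have hab := abs_sub_add_le h₁ h₂ (2 * (2 : ℝ) ^ (-(n : ℝ)))
  unfold covC
  rw [abs_sub_comm t₂ t₁] at *
  set δ := 2 * (2 : ℝ) ^ (-(n : ℝ))
  set a := |t₁ - t₂| + δ
  set b := t₁ + t₂ + δ
  have ha : 0 < a := by positivity
  have hb : 0 < b := ha.trans_le hab
  have h0 : (0 : ℝ) ∉ Set.uIcc a b := Set.notMem_uIcc_of_lt ha hb
  have hint : ∫ σ in a..b, mehlerK σ x y ≤ ∫ σ in a..b, σ⁻¹ * (2 * ‖x - y‖⁻¹) := by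
    refine intervalIntegral_mono_of_nonneg hab (fun σ hσ => mehlerK_nonneg (ha.trans hσ.1) x y)
      ((intervalIntegral.intervalIntegrable_inv (fun σ hσ h => h0 (h ▸ hσ))
        continuousOn_id).mul_const _) fun σ hσ => ?_
    exact (mehlerK_le_gaussKernel (ha.trans hσ.1) x y).trans
      (gaussKernel_le_inv_mul_inv_norm (ha.trans hσ.1) (sub_ne_zero.2 hxy))
  rw [intervalIntegral.integral_mul_const, integral_inv_of_pos ha hb] at hint
  have hlog : Real.log (b / a) ≤ Real.log ((2 * T + 1) / |t₁ - t₂|) := by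
    refine Real.log_le_log (by positivity) ?_
    have hbT : b ≤ 2 * T + 1 := by linarith
    have hM : 0 ≤ 2 * T + 1 := hb.le.trans hbT
    have : |t₁ - t₂| ≤ a := by linarith
    gcongr
  have := mul_le_mul_of_nonneg_right hlog (inv_nonneg.2 (norm_nonneg (x - y)))
  linarith

lemma covC_sq_le {T ε : ℝ} (hε : 0 < ε) (hn : 1 ≤ n) (h₁ : 0 < t₁) (h₂ : 0 < t₂) (hT₁ : t₁ ≤ T)
    (hT₂ : t₂ ≤ T) (hne : t₁ ≠ t₂) {x y : E3} (hxy : x ≠ y) :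
    covC n t₁ t₂ x y ^ 2 ≤
      (2 * T + 1) ^ ε * (2 / ε) ^ 2 * |t₁ - t₂| ^ (-ε) * (‖x - y‖ ^ 2)⁻¹ := by
  have hτ : 0 < |t₁ - t₂| := abs_pos.2 (sub_ne_zero.2 hne)
  have hM : 0 < 2 * T + 1 := by linarith
  have hlog := Real.log_le_rpow_div (div_pos hM hτ).le (half_pos hε)
  have hle := (covC_le_log_mul_inv_norm hn h₁ h₂ hT₁ hT₂ hne hxy).trans
    (mul_le_mul_of_nonneg_right hlog (inv_nonneg.2 (norm_nonneg (x - y))))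
  refine (pow_le_pow_left₀ (covC_nonneg h₁ h₂ x y) hle 2).trans_eq ?_
  have hpow : (((2 * T + 1) / |t₁ - t₂|) ^ (ε / 2)) ^ 2
      = (2 * T + 1) ^ ε * |t₁ - t₂| ^ (-ε) := by
    rw [← Real.rpow_natCast, ← Real.rpow_mul (div_pos hM hτ).le, Nat.cast_ofNat,
      div_mul_cancel₀ ε two_ne_zero, Real.div_rpow hM.le hτ.le, Real.rpow_neg hτ.le]
    rfl
  rw [mul_pow, div_pow, hpow, inv_pow]
  field_simp

end Covariance

lemma lintegral_gaussKernel {t : ℝ} (ht : 0 < t) (y : E3) :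
    ∫⁻ w, ENNReal.ofReal (gaussKernel t (y - w)) = ENNReal.ofReal ((4 * π) ^ ((3 : ℝ) / 2)) := by
  rw [lintegral_sub_left_eq_self (fun w : E3 => ENNReal.ofReal (gaussKernel t w)) y]
  have hb : 0 < (4 * t)⁻¹ := by positivity
  have hint := GaussianFourier.integral_rexp_neg_mul_sq_norm (V := E3) hb
  have hfun : gaussKernel t = fun w => t ^ (-(3 : ℝ) / 2) * Real.exp (-(4 * t)⁻¹ * ‖w‖ ^ 2) := by
    funext w
    unfold gaussKernel
    congr 2
    ring
  have hval : ∫ w, gaussKernel t w = (4 * π) ^ ((3 : ℝ) / 2) := by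
    rw [hfun, integral_const_mul, hint, finrank_euclideanSpace_fin, div_inv_eq_mul,
      show π * (4 * t) = t * (4 * π) by ring, Nat.cast_ofNat,
      Real.mul_rpow ht.le (by positivity), ← mul_assoc, ← Real.rpow_add ht]
    norm_num
  rw [← hval, ofReal_integral_eq_lintegral_ofReal _ (.of_forall (gaussKernel_nonneg ht))]
  refine not_imp_comm.1 integral_undef ?_
  rw [hval]
  positivity

lemma integrable_indicator_inv_norm_sq (r : ℝ) :
    Integrable (fun v : E3 => (Set.Iio r).indicator (fun s => (s ^ 2)⁻¹) ‖v‖) := by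
  rw [integrable_fun_norm_addHaar volume (f := (Set.Iio r).indicator fun s : ℝ => (s ^ 2)⁻¹)]
  have hone : IntegrableOn ((Set.Iio r).indicator fun _ : ℝ => (1 : ℝ)) (Set.Ioi 0) := by
    rw [IntegrableOn, integrable_indicator_iff measurableSet_Iio, IntegrableOn,
      Measure.restrict_restrict measurableSet_Iio]
    exact integrableOn_const (by simp [Set.Iio_inter_Ioi])
  refine hone.congr_fun (fun s (hs : 0 < s) => ?_) measurableSet_Ioi
  by_cases h : s < r
  · simp [h, hs.ne']
  · simp [h]

lemma integral_indicator_inv_norm_sq {r : ℝ} (hr : 0 < r) :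
    ∫ v : E3, (Set.Iio r).indicator (fun s => (s ^ 2)⁻¹) ‖v‖ =
      3 * volume.real (Metric.ball (0 : E3) 1) * r := by
  rw [integral_fun_norm_addHaar volume ((Set.Iio r).indicator fun s : ℝ => (s ^ 2)⁻¹),
    finrank_euclideanSpace_fin]
  have : ∫ s in Set.Ioi (0 : ℝ), s ^ (3 - 1) • (Set.Iio r).indicator (fun s => (s ^ 2)⁻¹) s = r := by
    calc _ = ∫ s in Set.Ioi (0 : ℝ), (Set.Iio r).indicator (fun _ => (1 : ℝ)) s := by
          refine setIntegral_congr_fun measurableSet_Ioi fun s (hs : 0 < s) => ?_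
          by_cases h : s < r
          · simp [h, hs.ne']
          · simp [h]
      _ = r := by
          rw [integral_indicator measurableSet_Iio, Measure.restrict_restrict measurableSet_Iio,
            Set.Iio_inter_Ioi]
          simp [hr.le]
  rw [this]
  simp [mul_assoc]

/-- The constant in the bound on the Gaussian potential of the inverse square. -/
def invSqPotentialConst : ℝ :=
  3 * volume.real (Metric.ball (0 : E3) 1) + (4 * π) ^ ((3 : ℝ) / 2)

lemma invSqPotentialConst_pos : 0 < invSqPotentialConst := by
  unfold invSqPotentialConst
  positivity

lemma lintegral_gaussKernel_mul_inv_sq_le {t : ℝ} (ht : 0 < t) (x y : E3) :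
    ∫⁻ w, ENNReal.ofReal (gaussKernel t (y - w) * (‖x - w‖ ^ 2)⁻¹) ≤
      ENNReal.ofReal (invSqPotentialConst * t⁻¹) := by
  have hs : 0 < √t := Real.sqrt_pos.2 ht
  have hpow : t ^ (-(3 : ℝ) / 2) * √t = t⁻¹ := by
    rw [Real.sqrt_eq_rpow, ← Real.rpow_neg_one, ← Real.rpow_add ht]
    norm_num
  set f : E3 → ℝ := fun v => (Set.Iio √t).indicator (fun s => (s ^ 2)⁻¹) ‖v‖
  have hf0 (v : E3) : 0 ≤ f v := Set.indicator_nonneg (fun _ _ => by positivity) _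
  have hpt (w : E3) : gaussKernel t (y - w) * (‖x - w‖ ^ 2)⁻¹ ≤
      t ^ (-(3 : ℝ) / 2) * f (x - w) + t⁻¹ * gaussKernel t (y - w) := by
    have hg := gaussKernel_nonneg ht (y - w)
    by_cases h : ‖x - w‖ < √t
    · have hfx : f (x - w) = (‖x - w‖ ^ 2)⁻¹ := Set.indicator_of_mem (Set.mem_Iio.2 h) _
      rw [hfx]
      have := mul_le_mul_of_nonneg_right (gaussKernel_le_rpow ht (y - w))
        (by positivity : 0 ≤ (‖x - w‖ ^ 2)⁻¹)
      have : 0 ≤ t⁻¹ * gaussKernel t (y - w) := by positivity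
      linarith
    · have hle : (‖x - w‖ ^ 2)⁻¹ ≤ t⁻¹ := by
        gcongr
        exact (Real.sqrt_le_left (norm_nonneg _)).1 (not_lt.1 h)
      have := mul_le_mul_of_nonneg_left hle hg
      have := mul_nonneg (by positivity : 0 ≤ t ^ (-(3 : ℝ) / 2)) (hf0 (x - w))
      linarith
  calc ∫⁻ w, ENNReal.ofReal (gaussKernel t (y - w) * (‖x - w‖ ^ 2)⁻¹)
      ≤ ∫⁻ w, (ENNReal.ofReal (t ^ (-(3 : ℝ) / 2)) * ENNReal.ofReal (f (x - w)) +
          ENNReal.ofReal t⁻¹ * ENNReal.ofReal (gaussKernel t (y - w))) := by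
        refine lintegral_mono fun w => (ENNReal.ofReal_le_ofReal (hpt w)).trans_eq ?_
        have h1 := hf0 (x - w)
        have h2 := gaussKernel_nonneg ht (y - w)
        rw [ENNReal.ofReal_add (by positivity) (by positivity),
          ENNReal.ofReal_mul (by positivity), ENNReal.ofReal_mul (by positivity)]
    _ = ENNReal.ofReal (t ^ (-(3 : ℝ) / 2)) * (∫⁻ v, ENNReal.ofReal (f v)) +
          ENNReal.ofReal t⁻¹ * ENNReal.ofReal ((4 * π) ^ ((3 : ℝ) / 2)) := by
        have hmeas := measurable_gaussKernel t
        rw [lintegral_add_right _ (by fun_prop), lintegral_const_mul' _ _ ENNReal.ofReal_ne_top,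
          lintegral_const_mul' _ _ ENNReal.ofReal_ne_top, lintegral_gaussKernel ht,
          lintegral_sub_left_eq_self (fun w : E3 => ENNReal.ofReal (f w)) x]
    _ = ENNReal.ofReal (invSqPotentialConst * t⁻¹) := by
        rw [← ofReal_integral_eq_lintegral_ofReal (integrable_indicator_inv_norm_sq √t)
            (.of_forall hf0), integral_indicator_inv_norm_sq hs,
          ← ENNReal.ofReal_mul (by positivity), ← ENNReal.ofReal_mul (by positivity),
          ← ENNReal.ofReal_add (by positivity) (by positivity), invSqPotentialConst]
        congr 1
        rw [← hpow]
        ring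

lemma lintegral_lintegral_gaussKernel_le_inv {a b : ℝ} (ha : 0 < a) (hb : 0 < b)
    (y₁ y₂ : E3) :
    ∫⁻ w₁, ∫⁻ w₂, ENNReal.ofReal
        (gaussKernel a (y₁ - w₁) * (gaussKernel b (y₂ - w₂) * (‖w₁ - w₂‖ ^ 2)⁻¹)) ≤
      ENNReal.ofReal ((4 * π) ^ ((3 : ℝ) / 2) * invSqPotentialConst * b⁻¹) := by
  have hmeas := measurable_gaussKernel a
  calc _ = ∫⁻ w₁, ENNReal.ofReal (gaussKernel a (y₁ - w₁)) *
          ∫⁻ w₂, ENNReal.ofReal (gaussKernel b (y₂ - w₂) * (‖w₁ - w₂‖ ^ 2)⁻¹) := by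
        refine lintegral_congr fun w₁ => ?_
        rw [← lintegral_const_mul' _ _ ENNReal.ofReal_ne_top]
        refine lintegral_congr fun w₂ => ?_
        rw [ENNReal.ofReal_mul (gaussKernel_nonneg ha _)]
    _ ≤ ∫⁻ w₁, ENNReal.ofReal (gaussKernel a (y₁ - w₁)) *
          ENNReal.ofReal (invSqPotentialConst * b⁻¹) := by
        gcongr with w₁
        exact lintegral_gaussKernel_mul_inv_sq_le hb w₁ y₂
    _ = _ := by
        rw [lintegral_mul_const' _ _ ENNReal.ofReal_ne_top, lintegral_gaussKernel ha,
          ← ENNReal.ofReal_mul (by positivity), mul_assoc]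

lemma inv_le_rpow_mul_rpow {a b : ℝ} (ha : 0 < a) (hab : a ≤ b) :
    b⁻¹ ≤ a ^ (-(1 : ℝ) / 2) * b ^ (-(1 : ℝ) / 2) := by
  have hb := ha.trans_le hab
  calc b⁻¹ = b ^ (-(1 : ℝ) / 2) * b ^ (-(1 : ℝ) / 2) := by
        rw [← Real.rpow_add hb, ← Real.rpow_neg_one]
        norm_num
    _ ≤ _ := by
        gcongr ?_ * _
        exact Real.rpow_le_rpow_of_nonpos ha hab (by norm_num)

lemma lintegral_lintegral_gaussKernel_le {a b : ℝ} (ha : 0 < a) (hb : 0 < b) (y₁ y₂ : E3) :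
    ∫⁻ w₁, ∫⁻ w₂, ENNReal.ofReal
        (gaussKernel a (y₁ - w₁) * (gaussKernel b (y₂ - w₂) * (‖w₁ - w₂‖ ^ 2)⁻¹)) ≤
      ENNReal.ofReal ((4 * π) ^ ((3 : ℝ) / 2) * invSqPotentialConst *
        (a ^ (-(1 : ℝ) / 2) * b ^ (-(1 : ℝ) / 2))) := by
  have hC := invSqPotentialConst_pos
  rcases le_total a b with hab | hab
  · refine (lintegral_lintegral_gaussKernel_le_inv ha hb y₁ y₂).trans ?_
    gcongr
    exact inv_le_rpow_mul_rpow ha hab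
  · have h₁ := measurable_gaussKernel a
    have h₂ := measurable_gaussKernel b
    rw [lintegral_lintegral_swap (by unfold Function.uncurry; fun_prop)]
    have h := lintegral_lintegral_gaussKernel_le_inv hb ha y₂ y₁
    simp only [mul_left_comm (gaussKernel b _), norm_sub_rev (_ : E3) (_ : E3)] at h ⊢
    refine h.trans ?_
    gcongr
    rw [mul_comm]
    exact inv_le_rpow_mul_rpow hb hab

/-- a uniform-in-`n` bound on a kernels/covariances integral
(estimate on `𝒞ℱ^{1,2}`). -/
theorem kernel_covariance_product_bound (T : ℝ) (hT : 0 < T) (ε : ℝ) (hε : 0 < ε) :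
    ∃ C : ℝ, 0 < C ∧
      ∀ t₁ t₂ s₁ s₂ : ℝ,
        0 < s₁ → s₁ < t₁ → t₁ ≤ T → 0 < s₂ → s₂ < t₂ → t₂ ≤ T →
        t₁ ≠ t₂ → t₁ ≠ s₂ → t₂ ≠ s₁ → s₁ ≠ s₂ →
        ∀ n : ℕ, 1 ≤ n → ∀ y₁ y₂ z₁ z₂ : EuclideanSpace ℝ (Fin 3),
          covC n t₁ t₂ z₁ z₂ *
              (∫ w₁, ∫ w₂,
                mehlerK (t₁ - s₁) y₁ w₁ * mehlerK (t₂ - s₂) y₂ w₂ *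
                  covC n t₁ s₂ z₁ w₂ * covC n t₂ s₁ z₂ w₁ * covC n s₁ s₂ w₁ w₂ ^ 2) ≤
            C * |t₁ - t₂| ^ (-(1 : ℝ) / 2) * |t₁ - s₂| ^ (-(1 : ℝ) / 2) *
              |t₂ - s₁| ^ (-(1 : ℝ) / 2) * |t₁ - s₁| ^ (-(1 : ℝ) / 2) *
                |t₂ - s₂| ^ (-(1 : ℝ) / 2) * |s₁ - s₂| ^ (-ε) := by
  have hD := invSqPotentialConst_pos
  set D := (4 * π) ^ ((3 : ℝ) / 2) * invSqPotentialConst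
  set B := (2 * T + 1) ^ ε * (2 / ε) ^ 2
  refine ⟨B * D, by positivity, ?_⟩
  intro t₁ t₂ s₁ s₂ hs₁ hst₁ hT₁ hs₂ hst₂ hT₂ htt hts₁ hts₂ hss n hn y₁ y₂ z₁ z₂
  have ht₁ := hs₁.trans hst₁
  have ht₂ := hs₂.trans hst₂
  have ha : 0 < t₁ - s₁ := sub_pos.2 hst₁
  have hb : 0 < t₂ - s₂ := sub_pos.2 hst₂
  rw [abs_of_pos ha, abs_of_pos hb]
  set A := |t₁ - s₂| ^ (-(1 : ℝ) / 2) * |t₂ - s₁| ^ (-(1 : ℝ) / 2) * (B * |s₁ - s₂| ^ (-ε))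
  set F : E3 → E3 → ℝ := fun w₁ w₂ => mehlerK (t₁ - s₁) y₁ w₁ * mehlerK (t₂ - s₂) y₂ w₂ *
    covC n t₁ s₂ z₁ w₂ * covC n t₂ s₁ z₂ w₁ * covC n s₁ s₂ w₁ w₂ ^ 2
  have hA : 0 ≤ A := by positivity
  have hF (w₁ w₂ : E3) (hw : w₁ ≠ w₂) : ‖F w₁ w₂‖ₑ ≤ ENNReal.ofReal A * ENNReal.ofReal
      (gaussKernel (t₁ - s₁) (y₁ - w₁) *
        (gaussKernel (t₂ - s₂) (y₂ - w₂) * (‖w₁ - w₂‖ ^ 2)⁻¹)) := by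
    have k₁ := mehlerK_nonneg ha y₁ w₁
    have k₂ := mehlerK_nonneg hb y₂ w₂
    have g₁ := gaussKernel_nonneg ha (y₁ - w₁)
    have g₂ := gaussKernel_nonneg hb (y₂ - w₂)
    have c₁ := covC_nonneg (n := n) ht₁ hs₂ z₁ w₂
    have c₂ := covC_nonneg (n := n) ht₂ hs₁ z₂ w₁
    rw [← ENNReal.ofReal_mul hA, Real.enorm_eq_ofReal (by positivity)]
    refine ENNReal.ofReal_le_ofReal ?_
    calc F w₁ w₂ ≤ gaussKernel (t₁ - s₁) (y₁ - w₁) * gaussKernel (t₂ - s₂) (y₂ - w₂) *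
          |t₁ - s₂| ^ (-(1 : ℝ) / 2) * |t₂ - s₁| ^ (-(1 : ℝ) / 2) *
          (B * |s₁ - s₂| ^ (-ε) * (‖w₁ - w₂‖ ^ 2)⁻¹) := by
          dsimp only [F]
          gcongr
          · exact mehlerK_le_gaussKernel ha y₁ w₁
          · exact mehlerK_le_gaussKernel hb y₂ w₂
          · exact covC_le_rpow ht₁ hs₂ hts₁ z₁ w₂
          · exact covC_le_rpow ht₂ hs₁ hts₂ z₂ w₁
          · exact covC_sq_le hε hn hs₁ hs₂ (hst₁.le.trans hT₁) (hst₂.le.trans hT₂) hss hw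
      _ = _ := by
          dsimp only [A]
          ring
  have hI : ‖∫ w₁, ∫ w₂, F w₁ w₂‖ₑ ≤
      ENNReal.ofReal (A * (D * ((t₁ - s₁) ^ (-(1 : ℝ) / 2) * (t₂ - s₂) ^ (-(1 : ℝ) / 2)))) := by
    calc ‖∫ w₁, ∫ w₂, F w₁ w₂‖ₑ ≤ ∫⁻ w₁, ∫⁻ w₂, ‖F w₁ w₂‖ₑ :=
          (enorm_integral_le_lintegral_enorm _).trans
            (lintegral_mono fun w₁ => enorm_integral_le_lintegral_enorm _)
      _ ≤ ∫⁻ w₁, ∫⁻ w₂, ENNReal.ofReal A * ENNReal.ofReal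
            (gaussKernel (t₁ - s₁) (y₁ - w₁) *
              (gaussKernel (t₂ - s₂) (y₂ - w₂) * (‖w₁ - w₂‖ ^ 2)⁻¹)) := by
          refine lintegral_mono fun w₁ => lintegral_mono_ae ?_
          filter_upwards [compl_mem_ae_iff.2 (measure_singleton w₁)] with w₂ hw₂
          exact hF w₁ w₂ (Ne.symm hw₂)
      _ ≤ _ := by
          simp_rw [lintegral_const_mul' _ _ ENNReal.ofReal_ne_top]
          rw [ENNReal.ofReal_mul hA]
          gcongr
          exact lintegral_lintegral_gaussKernel_le ha hb y₁ y₂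
  have hI' : ∫ w₁, ∫ w₂, F w₁ w₂ ≤
      A * (D * ((t₁ - s₁) ^ (-(1 : ℝ) / 2) * (t₂ - s₂) ^ (-(1 : ℝ) / 2))) := by
    refine (le_abs_self _).trans ?_
    rw [← ofReal_norm] at hI
    exact (ENNReal.ofReal_le_ofReal_iff (by positivity)).1 hI
  calc _ ≤ |t₁ - t₂| ^ (-(1 : ℝ) / 2) *
        (A * (D * ((t₁ - s₁) ^ (-(1 : ℝ) / 2) * (t₂ - s₂) ^ (-(1 : ℝ) / 2)))) :=
        (mul_le_mul_of_nonneg_left hI' (covC_nonneg ht₁ ht₂ z₁ z₂)).trans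
          (mul_le_mul_of_nonneg_right (covC_le_rpow ht₁ ht₂ htt z₁ z₂) (by positivity))
    _ = _ := by
        dsimp only [A]
        ring

end
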